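/- Fix κ ∈ (0,1), q ∈ [0,1], w > 0, and a finite Borel measure μ on [0,1] having a continuous, everywhere positive density with respect to Lebesgue measure. If there exists a pure-strategy Nash equilibrium (f*,a*), then κ > 1/2. -/

import Mathlib

open MeasureTheory Set

noncomputable section

/-- `μ` is a finite Borel measure on `[0,1]` with a continuous, everywhere positive
density with respect to Lebesgue measure. -/
def NiceDensity (μ : Measure ℝ) : Prop :=
  ∃ g : ℝ → ℝ, ContinuousOn g (Icc 0 1) ∧ (∀ p ∈ Icc (0:ℝ) 1, 0 < g p) ∧
    μ = (volume.restrict (Icc (0:ℝ) 1)).withDensity (fun p => ENNReal.ofReal (g p))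

/-- Total amount wagered by the diffuse players on Outcome 1. -/
def d1 (μ : Measure ℝ) (f : ℝ → ℝ × ℝ) : ℝ := ∫ p in Icc (0:ℝ) 1, (f p).1 ∂μ

/-- Total amount wagered by the diffuse players on Outcome 2. -/
def d2 (μ : Measure ℝ) (f : ℝ → ℝ × ℝ) : ℝ := ∫ p in Icc (0:ℝ) 1, (f p).2 ∂μ

/-- The implied probability of Outcome 1, `P^{f,a}`. -/
def impliedProb (μ : Measure ℝ) (f : ℝ → ℝ × ℝ) (a : ℝ × ℝ) : ℝ :=
  (d1 μ f + a.1) / (d1 μ f + d2 μ f + a.1 + a.2)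

/-- A feasible strategy profile for the diffuse players. -/
def FeasibleDiffuse (f : ℝ → ℝ × ℝ) : Prop :=
  Measurable f ∧ ∀ p ∈ Icc (0:ℝ) 1, 0 ≤ (f p).1 ∧ 0 ≤ (f p).2 ∧ (f p).1 + (f p).2 ≤ 1

/-- A feasible strategy profile for the atomic player. -/
def FeasibleAtomic (w : ℝ) (a : ℝ × ℝ) : Prop := 0 ≤ a.1 ∧ 0 ≤ a.2 ∧ a.1 + a.2 ≤ w

/-- The expected profit of a bettor who believes Outcome 1 occurs with probability `p`,
betting `b1` on Outcome 1 and `b2` on Outcome 2, when the implied probability of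
Outcome 1 is `P` (with the indicator conventions of the paper). -/
def payoff (κ P p b1 b2 : ℝ) : ℝ :=
  b1 * ((if P = 0 then 0 else κ * p / P) - 1) +
  b2 * ((if P = 1 then 0 else κ * (1 - p) / (1 - P)) - 1)

/-- A pure-strategy Nash equilibrium. -/
def IsEquilibrium (κ q w : ℝ) (μ : Measure ℝ) (f : ℝ → ℝ × ℝ) (a : ℝ × ℝ) : Prop :=
  FeasibleDiffuse f ∧ FeasibleAtomic w a ∧
  0 < d1 μ f + d2 μ f + a.1 + a.2 ∧
  (∀ p ∈ Icc (0:ℝ) 1,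
    payoff κ (impliedProb μ f a) p (f p).1 (f p).2 =
      sSup {x | ∃ b1 b2 : ℝ, 0 ≤ b1 ∧ 0 ≤ b2 ∧ b1 + b2 ≤ 1 ∧
        x = payoff κ (impliedProb μ f a) p b1 b2}) ∧
  payoff κ (impliedProb μ f a) q a.1 a.2 =
    sSup {x | ∃ b1 b2 : ℝ, 0 ≤ b1 ∧ 0 ≤ b2 ∧ b1 + b2 ≤ w ∧
      0 < d1 μ f + d2 μ f + b1 + b2 ∧
      x = payoff κ (impliedProb μ f (b1, b2)) q b1 b2}


theorem payoff_swap (κ P p b1 b2 : ℝ) :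
    payoff κ P p b1 b2 = payoff κ (1 - P) (1 - p) b2 b1 := by
  unfold payoff
  have h1 : (1 - P = 0) ↔ P = 1 := by constructor <;> intro h <;> linarith
  have h2 : (1 - P = 1) ↔ P = 0 := by constructor <;> intro h <;> linarith
  simp only [h1, h2, sub_sub_cancel]
  ring

theorem payoff_formula (κ q d2 a2 x : ℝ) (hd : 0 ≤ d2) (ha : 0 ≤ a2) (hx : 0 < x) :
    payoff κ (x / (d2 + x + a2)) q x a2 =
      κ * q * (d2 + a2 + x) - x + a2 / (d2 + a2) * (κ * (1 - q)) * (d2 + a2 + x) - a2 := by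
  have hD : 0 < d2 + x + a2 := by positivity
  have hP : x / (d2 + x + a2) ≠ 0 := by positivity
  unfold payoff
  rw [if_neg hP]
  rcases eq_or_lt_of_le (add_nonneg hd ha) with h0 | hs
  · have h1 : d2 = 0 := by linarith
    have h2 : a2 = 0 := by linarith
    subst h1 h2
    simp
    field_simp
  · have hP1 : x / (d2 + x + a2) ≠ 1 := by
      rw [Ne, div_eq_one_iff_eq hD.ne']
      intro h; linarith
    have h3 : 1 - x / (d2 + x + a2) = (d2 + a2) / (d2 + x + a2) := by
      field_simp; ring
    rw [if_neg hP1, h3]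
    field_simp
    ring

theorem payoff_strict (κ q d2 a1 a2 : ℝ) (hκ0 : 0 < κ) (hκ1 : κ < 1) (hq0 : 0 ≤ q) (hq1 : q ≤ 1)
    (hd : 0 ≤ d2) (ha : 0 ≤ a2) (hx : 0 < a1) :
    payoff κ (a1 / (d2 + a1 + a2)) q a1 a2 <
      payoff κ ((a1 / 2) / (d2 + a1 / 2 + a2)) q (a1 / 2) a2 := by
  rw [payoff_formula κ q d2 a2 a1 hd ha hx, payoff_formula κ q d2 a2 (a1/2) hd ha (by linarith)]
  have hr : a2 / (d2 + a2) ≤ 1 := div_le_one_of_le₀ (by linarith) (by linarith)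
  have h1 : a2 / (d2 + a2) * (κ * (1 - q)) ≤ κ * (1 - q) :=
    mul_le_of_le_one_left (mul_nonneg hκ0.le (by linarith)) hr
  have h2 : 0 < 1 - κ * q - a2 / (d2 + a2) * (κ * (1 - q)) := by linarith
  have h3 := mul_pos h2 hx
  nlinarith

theorem term_bound (c P b D : ℝ) (hc0 : 0 ≤ c) (hc1 : c ≤ 1) (hP : 0 ≤ P)
    (hb : 0 ≤ b) (hD : 0 ≤ D) (h : b ≤ P * D) :
    b * ((if P = 0 then 0 else c / P) - 1) ≤ D := by
  split_ifs with h0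
  · linarith
  · have hP' : 0 < P := lt_of_le_of_ne hP (Ne.symm h0)
    have : b * (c / P) ≤ D := by
      rw [← mul_div_assoc, div_le_iff₀ hP']
      nlinarith
    linarith

theorem payoff_bound (κ P q b1 b2 D : ℝ) (hκ0 : 0 < κ) (hκ1 : κ < 1) (hq0 : 0 ≤ q) (hq1 : q ≤ 1)
    (hP0 : 0 ≤ P) (hP1 : P ≤ 1) (hb1 : 0 ≤ b1) (hb2 : 0 ≤ b2) (hD : 0 ≤ D)
    (h1 : b1 ≤ P * D) (h2 : b2 ≤ (1 - P) * D) :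
    payoff κ P q b1 b2 ≤ 2 * D := by
  have e1 := term_bound (κ * q) P b1 D (by positivity) (by nlinarith) hP0 hb1 hD h1
  have e2 := term_bound (κ * (1 - q)) (1 - P) b2 D (mul_nonneg hκ0.le (by linarith))
    (by nlinarith) (by linarith) hb2 hD h2
  have h3 : (1 - P = 0) ↔ P = 1 := by constructor <;> intro h <;> linarith
  simp only [h3] at e2
  unfold payoff
  linarith

theorem diffuse_bdd (κ P p : ℝ) :
    BddAbove {x | ∃ b1 b2 : ℝ, 0 ≤ b1 ∧ 0 ≤ b2 ∧ b1 + b2 ≤ 1 ∧ x = payoff κ P p b1 b2} := by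
  unfold payoff
  generalize ((if P = 0 then 0 else κ * p / P) - 1 : ℝ) = u
  generalize ((if P = 1 then 0 else κ * (1 - p) / (1 - P)) - 1 : ℝ) = v
  refine ⟨|u| + |v|, ?_⟩
  rintro x ⟨b1, b2, h1, h2, h3, rfl⟩
  have e1 : b1 * u ≤ |u| := by nlinarith [le_abs_self u, abs_nonneg u]
  have e2 : b2 * v ≤ |v| := by nlinarith [le_abs_self v, abs_nonneg v]
  linarith

theorem nice_null (μ : Measure ℝ) (hμ : NiceDensity μ) (c : ℝ) :
    ∀ᵐ p ∂(μ.restrict (Icc (0:ℝ) 1)), p ∈ Icc (0:ℝ) 1 ∧ p ≠ c := by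
  obtain ⟨g, -, -, rfl⟩ := hμ
  set ν := (volume.restrict (Icc (0:ℝ) 1)).withDensity (fun p => ENNReal.ofReal (g p)) with hν
  have hac : ν ≪ volume :=
    (withDensity_absolutelyContinuous _ _).trans Measure.restrict_le_self.absolutelyContinuous
  have h0 : ∀ᵐ p ∂ν, p ≠ c := by
    apply hac.ae_le
    exact Measure.ae_ne volume c
  filter_upwards [ae_restrict_mem measurableSet_Icc, ae_restrict_of_ae h0] with p hp hp'
  exact ⟨hp, hp'⟩

/-- Theorem (necessity): if a pure-strategy Nash equilibrium exists, then `κ > 1/2`. -/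
theorem stmt_5 (κ q w : ℝ) (hκ : κ ∈ Ioo (0:ℝ) 1) (hq : q ∈ Icc (0:ℝ) 1) (hw : 0 < w)
    (μ : Measure ℝ) (hμ : NiceDensity μ)
    (h : ∃ (f : ℝ → ℝ × ℝ) (a : ℝ × ℝ), IsEquilibrium κ q w μ f a) :
    κ > 1/2 := by
  obtain ⟨f, a, ⟨-, hf⟩, ⟨ha1, ha2, haw⟩, hpos, hdiff, hat⟩ := h
  obtain ⟨hκ0, hκ1⟩ := hκ
  obtain ⟨hq0, hq1⟩ := hq
  by_contra hcon
  have hκ2 : κ ≤ 1 / 2 := not_lt.mp hcon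
  have hd1 : 0 ≤ d1 μ f := setIntegral_nonneg measurableSet_Icc fun p hp => (hf p hp).1
  have hd2 : 0 ≤ d2 μ f := setIntegral_nonneg measurableSet_Icc fun p hp => (hf p hp).2.1
  -- the atomic player's payoffs are bounded
  have hbdd : BddAbove {x | ∃ b1 b2 : ℝ, 0 ≤ b1 ∧ 0 ≤ b2 ∧ b1 + b2 ≤ w ∧
      0 < d1 μ f + d2 μ f + b1 + b2 ∧
      x = payoff κ (impliedProb μ f (b1, b2)) q b1 b2} := by
    refine ⟨2 * (d1 μ f + d2 μ f + w), ?_⟩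
    rintro x ⟨b1, b2, h1, h2, h3, h4, rfl⟩
    have hPD : impliedProb μ f (b1, b2) * (d1 μ f + d2 μ f + b1 + b2) = d1 μ f + b1 := by
      unfold impliedProb
      exact div_mul_cancel₀ _ h4.ne'
    have hP0 : 0 ≤ impliedProb μ f (b1, b2) := div_nonneg (by simp; linarith) h4.le
    have hP1 : impliedProb μ f (b1, b2) ≤ 1 := div_le_one_of_le₀ (by simp; linarith) h4.le
    have := payoff_bound κ _ q b1 b2 _ hκ0 hκ1 hq0 hq1 hP0 hP1 h1 h2 h4.le
      (by linarith) (by linarith)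
    linarith
  have hdev : ∀ b1 b2 : ℝ, 0 ≤ b1 → 0 ≤ b2 → b1 + b2 ≤ w → 0 < d1 μ f + d2 μ f + b1 + b2 →
      payoff κ (impliedProb μ f (b1, b2)) q b1 b2 ≤ payoff κ (impliedProb μ f a) q a.1 a.2 := by
    intro b1 b2 h1 h2 h3 h4
    rw [hat]
    exact le_csSup hbdd ⟨b1, b2, h1, h2, h3, h4, rfl⟩
  have hddev : ∀ p ∈ Icc (0:ℝ) 1, ∀ b1 b2 : ℝ, 0 ≤ b1 → 0 ≤ b2 → b1 + b2 ≤ 1 →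
      payoff κ (impliedProb μ f a) p b1 b2 ≤
        payoff κ (impliedProb μ f a) p (f p).1 (f p).2 := by
    intro p hp b1 b2 h1 h2 h3
    rw [hdiff p hp]
    exact le_csSup (diffuse_bdd _ _ _) ⟨b1, b2, h1, h2, h3, rfl⟩
  have hPeq : impliedProb μ f a = (d1 μ f + a.1) / (d1 μ f + d2 μ f + a.1 + a.2) := rfl
  rcases le_or_gt κ (impliedProb μ f a) with hP | hP
  · have hPpos : 0 < impliedProb μ f a := by linarith
    have hz : d1 μ f = 0 := by
      refine integral_eq_zero_of_ae ?_
      filter_upwards [nice_null μ hμ 1] with p hp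
      obtain ⟨hp, hp1⟩ := hp
      obtain ⟨g1, g2, g3⟩ := hf p hp
      have h := hddev p hp 0 (f p).2 le_rfl g2 (by linarith)
      unfold payoff at h
      rw [if_neg hPpos.ne'] at h
      have hlt : p < 1 := lt_of_le_of_ne hp.2 hp1
      have hc : κ * p / impliedProb μ f a < 1 := by
        rw [div_lt_one hPpos]; nlinarith
      show (f p).1 = 0
      nlinarith
    have ha1' : 0 < a.1 := by
      rcases eq_or_lt_of_le ha1 with h | h
      · rw [hPeq, hz, ← h] at hPpos
        simp at hPpos
      · exact h
    have h := hdev (a.1 / 2) a.2 (by linarith) ha2 (by linarith) (by linarith)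
    have hs := payoff_strict κ q (d2 μ f) a.1 a.2 hκ0 hκ1 hq0 hq1 hd2 ha2 ha1'
    simp only [impliedProb, hz, zero_add] at h
    linarith
  · have hPpos : 0 < 1 - impliedProb μ f a := by linarith
    have hz : d2 μ f = 0 := by
      refine integral_eq_zero_of_ae ?_
      filter_upwards [nice_null μ hμ 0] with p hp
      obtain ⟨hp, hp1⟩ := hp
      obtain ⟨g1, g2, g3⟩ := hf p hp
      have h := hddev p hp (f p).1 0 g1 le_rfl (by linarith)
      unfold payoff at h
      rw [if_neg (show ¬ impliedProb μ f a = 1 by intro h; linarith)] at h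
      have hlt : 0 < p := lt_of_le_of_ne hp.1 (Ne.symm hp1)
      have hc : κ * (1 - p) / (1 - impliedProb μ f a) < 1 := by
        rw [div_lt_one hPpos]; nlinarith
      show (f p).2 = 0
      nlinarith
    have h1P : ∀ x y : ℝ, 0 < d1 μ f + d2 μ f + x + y →
        1 - impliedProb μ f (x, y) = y / (d1 μ f + y + x) := by
      intro x y hxy
      rw [hz] at hxy
      have e : d1 μ f + y + x ≠ 0 := by intro h; linarith
      have e' : d1 μ f + x + y ≠ 0 := by intro h; linarith
      simp only [impliedProb, hz, add_zero]
      rw [show d1 μ f + y + x = d1 μ f + x + y by ring]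
      field_simp
      ring
    have hPa := h1P a.1 a.2 hpos
    have ha2' : 0 < a.2 := by
      rcases eq_or_lt_of_le ha2 with h | h
      · rw [show impliedProb μ f a = impliedProb μ f (a.1, a.2) from rfl, hPa, ← h] at hPpos
        simp at hPpos
      · exact h
    have hden : 0 < d1 μ f + d2 μ f + a.1 + a.2 / 2 := by linarith
    have h := hdev a.1 (a.2 / 2) ha1 (by linarith) (by linarith) hden
    have hs := payoff_strict κ (1 - q) (d1 μ f) a.2 a.1 hκ0 hκ1 (by linarith) (by linarith)
      hd1 ha1 ha2'
    rw [payoff_swap, h1P _ _ hden, payoff_swap κ (impliedProb μ f a),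
      show impliedProb μ f a = impliedProb μ f (a.1, a.2) from rfl, hPa] at h
    linarith
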